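/- arXiv:1003.3274 — 3 statements merged into one kernel-verified Lean document; each statement's English description precedes it below -/
import Mathlib

section
/- Let K be a commutative ring equipped with two commuting derivations δt and δx (additive maps satisfying the Leibniz rule d(ab) = d(a)·b + a·d(b), with δt∘δx = δx∘δt). Let λ ∈ K be invertible with δt(λ) + δx(δx(λ)) = 0. If u ∈ K satisfies δt(u) − δx(δx(u)) + 2·λ⁻¹·δx(λ)·δx(u) = 0, then v := λ⁻¹·δx(u) satisfies the heat equation δt(v) − δx(δx(v)) = 0. -/
/-- A map satisfying the Leibniz rule acts on inverses by the quotient rule. -/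
theorem leibniz_inverse {K : Type*} [CommRing K] (d : K → K)
    (d_mul : ∀ a b : K, d (a * b) = d a * b + a * d b)
    {a b : K} (h : b * a = 1) : d b = -(b * b * d a) := by
  have h_one : d 1 = 0 := by
    have := d_mul 1 1
    simp only [mul_one, one_mul] at this
    linear_combination -this
  have h_prod := d_mul b a
  rw [h, h_one] at h_prod
  linear_combination (-b) * h_prod - d b * h

/-- If `λ` is invertible with `δt λ + δx² λ = 0` and `u` satisfies
`δt u − δx² u + 2 (δx λ / λ) δx u = 0`, then `v = λ⁻¹ δx u` satisfies the heat
equation `δt v − δx² v = 0`. -/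
theorem stmt7 {K : Type*} [CommRing K]
    (δt δx : K → K)
    (ht_add : ∀ a b : K, δt (a + b) = δt a + δt b)
    (ht_mul : ∀ a b : K, δt (a * b) = δt a * b + a * δt b)
    (hx_add : ∀ a b : K, δx (a + b) = δx a + δx b)
    (hx_mul : ∀ a b : K, δx (a * b) = δx a * b + a * δx b)
    (hcomm : ∀ a : K, δt (δx a) = δx (δt a))
    (l li : K) (hli : li * l = 1)
    (hl : δt l + δx (δx l) = 0)
    (u : K) (hu : δt u - δx (δx u) + 2 * li * δx l * δx u = 0) :
    δt (li * δx u) - δx (δx (li * δx u)) = 0 := by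
  have ht_inv := leibniz_inverse δt ht_mul hli
  have hx_inv := leibniz_inverse δx hx_mul hli
  have hxx_inv : δx (δx li) + (2 * li * δx li * δx l + li * li * δx (δx l)) = 0 := by
    have h_zero : δx 0 = 0 := by simpa using hx_add 0 0
    have h_sum : δx li + li * li * δx l = 0 := by linear_combination hx_inv
    have h := congrArg δx h_sum
    rw [hx_add, hx_mul, hx_mul, h_zero] at h
    linear_combination h
  have hu_sum : δt u + (li * δx l * δx u + li * δx l * δx u) = δx (δx u) := by
    linear_combination hu
  have hu_deriv := congrArg δx hu_sum
  simp only [hx_add, hx_mul] at hu_deriv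
  simp only [ht_mul, hx_mul, hx_add, hcomm, ht_inv]
  rw [hx_inv] at hu_deriv hxx_inv ⊢
  linear_combination li * hu_deriv - δx u * hxx_inv - li * li * δx u * hl
end

section
/- Let K be a field of characteristic zero equipped with two commuting derivations δx and δt (additive maps satisfying the Leibniz rule d(ab) = d(a)·b + a·d(b), with δx∘δt = δt∘δx), and let x ∈ K satisfy δx(x) = 1 and δt(x) = 0. If a ∈ K satisfies x·δx(a) − a = 0 and x·δx(δx(a)) − 2·δx(a) − x·δt(a) = 0, then a = 0. -/
/-- In a field of characteristic zero with commuting derivations `δx, δt` and an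
element `x` with `δx x = 1`, `δt x = 0`: if `x δx a − a = 0` and
`x δx² a − 2 δx a − x δt a = 0`, then `a = 0`. -/
theorem stmt8 {K : Type*} [Field K] [CharZero K]
    (δx δt : K → K)
    (hx_add : ∀ a b : K, δx (a + b) = δx a + δx b)
    (hx_mul : ∀ a b : K, δx (a * b) = δx a * b + a * δx b)
    (ht_add : ∀ a b : K, δt (a + b) = δt a + δt b)
    (ht_mul : ∀ a b : K, δt (a * b) = δt a * b + a * δt b)
    (hcomm : ∀ a : K, δx (δt a) = δt (δx a))
    (x : K) (hx1 : δx x = 1) (hx2 : δt x = 0)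
    (a : K)
    (h1 : x * δx a - a = 0)
    (h2 : x * δx (δx a) - 2 * δx a - x * δt a = 0) :
    a = 0 := by
  have hx0 : δx 0 = 0 := by simpa using hx_add 0 0
  have ht0 : δt 0 = 0 := by simpa using ht_add 0 0
  have hx : x ≠ 0 := by
    rintro rfl
    exact zero_ne_one (hx0.symm.trans hx1)
  obtain ⟨b, hb⟩ : ∃ b, b = δx a := ⟨_, rfl⟩
  rw [← hb] at h1 h2
  have hab : a = x * b := (sub_eq_zero.mp h1).symm
  have hxb : δx b = 0 := by
    have h := hx_mul x b
    rw [← hab, ← hb, hx1, one_mul, left_eq_add] at h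
    exact (mul_eq_zero.mp h).resolve_left hx
  have hta : δt a = x * δt b := by
    rw [hab, ht_mul, hx2, zero_mul, zero_add]
  have hxt : δx (δt b) = 0 := by rw [hcomm, hxb, ht0]
  have key : x * x * δt b + (b + b) = 0 := by
    rw [hxb, hta] at h2
    linear_combination -h2
  have hd : (2 * x) * δt b = 0 := by
    have h := congrArg δx key
    rw [hx_add, hx_add, hx_mul, hx_mul, hx1, hxt, hxb, hx0] at h
    linear_combination h
  have htb : δt b = 0 :=
    (mul_eq_zero.mp hd).resolve_left (mul_ne_zero two_ne_zero hx)
  have hb0 : b = 0 := by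
    rw [htb, mul_zero, zero_add, ← two_mul] at key
    exact (mul_eq_zero.mp key).resolve_left two_ne_zero
  rw [hab, hb0, mul_zero]
end

section
/- Let A be a commutative ring equipped with two commuting derivations δx and δy (additive maps satisfying the Leibniz rule d(ab) = d(a)·b + a·d(b), with δx∘δy = δy∘δx), and let x ∈ A satisfy δx(x) = 1 and δy(x) = 0. If z ∈ A satisfies δx(z) + z = 0 and δx(z) + x·δy(z) = 0, then z = 0. -/
/-- In a commutative ring with commuting derivations `δx, δy` and `x` with
`δx x = 1`, `δy x = 0`: if `δx z + z = 0` and `δx z + x·δy z = 0`, then `z = 0`. -/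
theorem stmt10 {A : Type*} [CommRing A]
    (δx δy : A → A)
    (hx_add : ∀ a b : A, δx (a + b) = δx a + δx b)
    (hx_mul : ∀ a b : A, δx (a * b) = δx a * b + a * δx b)
    (hy_add : ∀ a b : A, δy (a + b) = δy a + δy b)
    (hy_mul : ∀ a b : A, δy (a * b) = δy a * b + a * δy b)
    (hcomm : ∀ a : A, δx (δy a) = δy (δx a))
    (x : A) (hx : δx x = 1) (hy : δy x = 0)
    (z : A) (h1 : δx z + z = 0) (h2 : δx z + x * δy z = 0) :
    z = 0 := by
  have hy_zero : δy 0 = 0 := by simpa using hy_add 0 0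
  have hz : z = x * δy z := by linear_combination h1 - h2
  have hw : δx (δy z) + δy z = 0 := by
    rw [hcomm, ← hy_add, h1, hy_zero]
  have hxz : δx z = δy z + x * δx (δy z) := by
    have h := hx_mul x (δy z)
    rwa [← hz, hx, one_mul] at h
  have hw_zero : δy z = 0 := by linear_combination h2 - hxz - x * hw
  rw [hz, hw_zero, mul_zero]
end
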